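/- Let μ ∈ ℝ, σ > 0 and τ_l < τ_u, let F be the cumulative distribution function and f the density of the truncated normal distribution TN(μ,σ,τ_l,τ_u). Then: (i) for every x ≤ 0, lim_{n→∞} (F(τ_u + x/(n f(τ_u))))ⁿ = e^x, and (ii) for every x ≥ 0, lim_{n→∞} (1 − F(τ_l + x/(n f(τ_l))))ⁿ = e^{−x}. Equivalently, if X₁,…,Xₙ are i.i.d. with distribution TN(μ,σ,τ_l,τ_u), then n f(τ_u)(max_i X_i − τ_u) converges in distribution to the negative of a standard exponential random variable, and n f(τ_l)(min_i X_i − τ_l) converges in distribution to a standard exponential random variable. -/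

import Mathlib

open Real Filter Topology

/-- The standard normal density `φ(x) = (1/√(2π)) e^{-x²/2}`. -/
noncomputable def stdPhi (x : ℝ) : ℝ := (Real.sqrt (2 * Real.pi))⁻¹ * Real.exp (-(x ^ 2) / 2)

/-- The standard normal cumulative distribution function `Φ`. -/
noncomputable def stdPhiCDF (x : ℝ) : ℝ := ∫ t in Set.Iic x, stdPhi t

/-- The cumulative distribution function of the truncated normal distribution
`TN(μ,σ,τ_l,τ_u)`. -/
noncomputable def truncNormalCDF (μ σ τl τu : ℝ) (t : ℝ) : ℝ :=
  if t < τl then 0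
  else if τu < t then 1
  else (stdPhiCDF ((t - μ) / σ) - stdPhiCDF ((τl - μ) / σ)) /
    (stdPhiCDF ((τu - μ) / σ) - stdPhiCDF ((τl - μ) / σ))

lemma stdPhi_pos (x : ℝ) : 0 < stdPhi x := by
  unfold stdPhi
  positivity

lemma continuous_stdPhi : Continuous stdPhi := by
  unfold stdPhi
  fun_prop

lemma integrable_stdPhi : MeasureTheory.Integrable stdPhi := by
  refine ((integrable_exp_neg_mul_sq (b := 1 / 2) (by norm_num)).const_mul
    (Real.sqrt (2 * Real.pi))⁻¹).congr (.of_forall fun x => ?_)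
  simp only [stdPhi]
  ring_nf

lemma hasDerivAt_stdPhiCDF (x : ℝ) : HasDerivAt stdPhiCDF (stdPhi x) x := by
  have hcdf : stdPhiCDF = fun y => stdPhiCDF 0 + ∫ t in (0 : ℝ)..y, stdPhi t := by
    ext y
    rw [← intervalIntegral.integral_Iic_sub_Iic integrable_stdPhi.integrableOn
      integrable_stdPhi.integrableOn]
    simp only [stdPhiCDF]
    ring
  rw [hcdf]
  exact (intervalIntegral.integral_hasDerivAt_right integrable_stdPhi.intervalIntegrable
    continuous_stdPhi.stronglyMeasurable.stronglyMeasurableAtFilter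
    continuous_stdPhi.continuousAt).const_add _

lemma strictMono_stdPhiCDF : StrictMono stdPhiCDF :=
  strictMono_of_deriv_pos fun x => by
    rw [(hasDerivAt_stdPhiCDF x).deriv]
    exact stdPhi_pos x

section TruncNormal

variable {μ σ τl τu : ℝ}

lemma stdPhiCDF_sub_pos (hσ : 0 < σ) (h : τl < τu) :
    0 < stdPhiCDF ((τu - μ) / σ) - stdPhiCDF ((τl - μ) / σ) :=
  sub_pos.2 <| strictMono_stdPhiCDF <| by gcongr

lemma truncNormalCDF_of_mem {t : ℝ} (ht : t ∈ Set.Icc τl τu) :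
    truncNormalCDF μ σ τl τu t = (stdPhiCDF ((t - μ) / σ) - stdPhiCDF ((τl - μ) / σ)) /
      (stdPhiCDF ((τu - μ) / σ) - stdPhiCDF ((τl - μ) / σ)) := by
  rw [truncNormalCDF, if_neg ht.1.not_gt, if_neg ht.2.not_gt]

lemma truncNormalCDF_left (h : τl ≤ τu) : truncNormalCDF μ σ τl τu τl = 0 := by
  simp [truncNormalCDF_of_mem (Set.left_mem_Icc.2 h)]

lemma truncNormalCDF_right (hσ : 0 < σ) (h : τl < τu) : truncNormalCDF μ σ τl τu τu = 1 := by
  rw [truncNormalCDF_of_mem (Set.right_mem_Icc.2 h.le), div_self (stdPhiCDF_sub_pos hσ h).ne']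

/-- On its support, the truncated normal CDF has the truncated normal density as derivative. -/
lemma hasDerivWithinAt_truncNormalCDF {t : ℝ} (ht : t ∈ Set.Icc τl τu) :
    HasDerivWithinAt (truncNormalCDF μ σ τl τu)
      ((1 / σ) * stdPhi ((t - μ) / σ) /
        (stdPhiCDF ((τu - μ) / σ) - stdPhiCDF ((τl - μ) / σ))) (Set.Icc τl τu) t := by
  have hlin : HasDerivAt (fun s : ℝ => (s - μ) / σ) (1 / σ) t :=
    ((hasDerivAt_id t).sub_const μ).div_const σ
  have hcomp := (((hasDerivAt_stdPhiCDF ((t - μ) / σ)).comp t hlin).sub_const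
    (stdPhiCDF ((τl - μ) / σ))).div_const
      (stdPhiCDF ((τu - μ) / σ) - stdPhiCDF ((τl - μ) / σ))
  rw [mul_comm (1 / σ)]
  exact hcomp.hasDerivWithinAt.congr (fun s hs => truncNormalCDF_of_mem hs)
    (truncNormalCDF_of_mem ht)

end TruncNormal

lemma tendsto_const_div_natCast_mul (x d : ℝ) :
    Tendsto (fun n : ℕ => x / (n * d)) atTop (𝓝 0) := by
  simpa [div_div, mul_comm d] using tendsto_const_div_atTop_nhds_zero_nat (x / d)

/-- If `G a = 1` and `G` has derivative `d ≠ 0` at `a` within `s`, then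
`G (a + x / (n d)) ^ n → exp x`, as long as the evaluation points lie in `s`. -/
lemma HasDerivWithinAt.tendsto_pow_exp {G : ℝ → ℝ} {s : Set ℝ} {a d x : ℝ}
    (hG : HasDerivWithinAt G d s a) (hd : d ≠ 0) (ha : G a = 1)
    (hs : ∀ᶠ n : ℕ in atTop, a + x / (n * d) ∈ s) :
    Tendsto (fun n : ℕ => G (a + x / (n * d)) ^ n) atTop (𝓝 (Real.exp x)) := by
  have hscaled : Tendsto (fun n : ℕ => (n : ℝ) • (x / (n * d))) atTop (𝓝 (x / d)) := by
    refine tendsto_const_nhds.congr' ?_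
    filter_upwards [eventually_ne_atTop 0] with n hn
    have : (n : ℝ) ≠ 0 := Nat.cast_ne_zero.2 hn
    simp only [smul_eq_mul]
    field_simp
  have hlim := hG.hasFDerivWithinAt.lim (tendsto_const_div_natCast_mul x d) hs hscaled
  have hexp := Real.tendsto_one_add_pow_exp_of_tendsto (t := x)
    (g := fun n : ℕ => G (a + x / (n * d)) - 1) (by simpa [ha, hd] using hlim)
  simpa using hexp

/-- For the CDF `F` and density `f` of `TN(μ,σ,τ_l,τ_u)`:
(i) for every `x ≤ 0`, `F(τ_u + x/(n f(τ_u)))ⁿ → e^x`, and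
(ii) for every `x ≥ 0`, `(1 − F(τ_l + x/(n f(τ_l))))ⁿ → e^{−x}`, as `n → ∞`.
Equivalently, `n f(τ_u)(max_i X_i − τ_u)` converges in distribution to minus a standard
exponential and `n f(τ_l)(min_i X_i − τ_l)` to a standard exponential. -/
theorem stmt13 (μ σ τl τu : ℝ) (hσ : 0 < σ) (h : τl < τu)
    (fτl fτu : ℝ)
    (hfl : fτl = (1 / σ) * stdPhi ((τl - μ) / σ) /
      (stdPhiCDF ((τu - μ) / σ) - stdPhiCDF ((τl - μ) / σ)))
    (hfu : fτu = (1 / σ) * stdPhi ((τu - μ) / σ) /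
      (stdPhiCDF ((τu - μ) / σ) - stdPhiCDF ((τl - μ) / σ))) :
    (∀ x : ℝ, x ≤ 0 →
        Tendsto (fun n : ℕ => (truncNormalCDF μ σ τl τu (τu + x / (n * fτu))) ^ n)
          atTop (𝓝 (Real.exp x))) ∧
      (∀ x : ℝ, 0 ≤ x →
        Tendsto (fun n : ℕ => (1 - truncNormalCDF μ σ τl τu (τl + x / (n * fτl))) ^ n)
          atTop (𝓝 (Real.exp (-x)))) := by
  have hZ := stdPhiCDF_sub_pos (μ := μ) hσ h
  have hfl_pos : 0 < fτl := hfl ▸ div_pos (mul_pos (by positivity) (stdPhi_pos _)) hZ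
  have hfu_pos : 0 < fτu := hfu ▸ div_pos (mul_pos (by positivity) (stdPhi_pos _)) hZ
  have hderiv_u := hasDerivWithinAt_truncNormalCDF (μ := μ) (σ := σ) (Set.right_mem_Icc.2 h.le)
  have hderiv_l := hasDerivWithinAt_truncNormalCDF (μ := μ) (σ := σ) (Set.left_mem_Icc.2 h.le)
  rw [← hfu] at hderiv_u
  rw [← hfl] at hderiv_l
  refine ⟨fun x hx => hderiv_u.tendsto_pow_exp hfu_pos.ne' (truncNormalCDF_right hσ h) ?_,
    fun x hx => ?_⟩
  · filter_upwards [(tendsto_const_div_natCast_mul x fτu).eventually_const_lt (sub_neg.2 h)]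
      with n hn
    have : x / (n * fτu) ≤ 0 := div_nonpos_of_nonpos_of_nonneg hx (by positivity)
    constructor <;> linarith
  · have hlim := (hderiv_l.const_sub 1).tendsto_pow_exp (x := -x) (neg_ne_zero.2 hfl_pos.ne')
      (by simp [truncNormalCDF_left h.le]) ?_
    · simpa only [mul_neg, neg_div_neg_eq] using hlim
    · filter_upwards [(tendsto_const_div_natCast_mul x fτl).eventually_lt_const (sub_pos.2 h)]
        with n hn
      have : 0 ≤ x / (n * fτl) := by positivity
      rw [mul_neg, neg_div_neg_eq]
      constructor <;> linarith
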